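/- S·J̃·S = J̃·S, and the rank of the matrix J̃·S equals 1. -/

import Mathlib

namespace Matrix

variable {m : Type*} [Fintype m] [DecidableEq m]

theorem laplacian_mulVec_apply (A : Matrix m m ℝ) (x : m → ℝ) (i : m) :
    ((diagonal (fun i => ∑ j, A i j) - A) *ᵥ x) i = ∑ j, A i j * (x i - x j) := by
  rw [sub_mulVec, Pi.sub_apply, mulVec_diagonal]
  simp [mul_sub, Finset.sum_mul, mulVec, dotProduct]

/-- The Laplacian of a nonnegative matrix is accretive for the supremum norm. -/
theorem exists_forall_abs_le_abs_add_laplacian [Nonempty m] {A : Matrix m m ℝ}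
    (hA : ∀ i j, 0 ≤ A i j) (x : m → ℝ) {t : ℝ} (ht : 0 ≤ t) :
    ∃ i, ∀ j, |x j| ≤ |x i + t * ((diagonal (fun i => ∑ j, A i j) - A) *ᵥ x) i| := by
  obtain ⟨i, hi⟩ := Finite.exists_max fun i => |x i|
  refine ⟨i, fun j => (hi j).trans ?_⟩
  rw [laplacian_mulVec_apply]
  rcases le_total 0 (x i) with h | h
  · have hs : 0 ≤ t * ∑ j, A i j * (x i - x j) :=
      mul_nonneg ht <| Finset.sum_nonneg fun j _ => mul_nonneg (hA i j) <| by
        have := (le_abs_self (x j)).trans (hi j)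
        rw [abs_of_nonneg h] at this
        linarith
    rw [abs_of_nonneg h, abs_of_nonneg (by linarith)]
    linarith
  · have hs : t * ∑ j, A i j * (x i - x j) ≤ 0 :=
      mul_nonpos_of_nonneg_of_nonpos ht <|
        Finset.sum_nonpos fun j _ => mul_nonpos_of_nonneg_of_nonpos (hA i j) <| by
          have := (neg_le_abs (x j)).trans (hi j)
          rw [abs_of_nonpos h] at this
          linarith
    rw [abs_of_nonpos h, abs_of_nonpos (by linarith)]
    linarith

theorem laplacian_mulVec_eq_zero_of_sq {A : Matrix m m ℝ} (hA : ∀ i j, 0 ≤ A i j)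
    {L : Matrix m m ℝ} (hL : L = diagonal (fun i => ∑ j, A i j) - A) {x : m → ℝ}
    (hx : L *ᵥ (L *ᵥ x) = 0) : L *ᵥ x = 0 := by
  funext k
  have : Nonempty m := ⟨k⟩
  obtain ⟨i₀, hi₀⟩ := Finite.exists_max fun i => |x i|
  have bound (t : ℝ) (ht : 0 ≤ t) : |x k - t * (L *ᵥ x) k| ≤ |x i₀| := by
    obtain ⟨i, hi⟩ := exists_forall_abs_le_abs_add_laplacian hA (x - t • (L *ᵥ x)) ht
    rw [← hL] at hi
    have := hi k
    simp only [mulVec_sub, mulVec_smul, hx, smul_zero, Pi.sub_apply, Pi.smul_apply,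
      Pi.zero_apply, smul_eq_mul, sub_zero, sub_add_cancel] at this
    exact this.trans (hi₀ i)
  by_contra hne
  have hpos : 0 < |(L *ᵥ x) k| := abs_pos.mpr hne
  have ht : 0 ≤ (2 * |x i₀| + 1) / |(L *ᵥ x) k| := by positivity
  have h := bound _ ht
  have h₁ : |(2 * |x i₀| + 1) / |(L *ᵥ x) k| * (L *ᵥ x) k| = 2 * |x i₀| + 1 := by
    rw [abs_mul, abs_of_nonneg ht, div_mul_cancel₀ _ hpos.ne']
  have h₂ := abs_sub_abs_le_abs_sub
    ((2 * |x i₀| + 1) / |(L *ᵥ x) k| * (L *ᵥ x) k) (x k)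
  rw [abs_sub_comm, h₁] at h₂
  linarith [hi₀ k]

theorem rank_laplacian_sq {A : Matrix m m ℝ} (hA : ∀ i j, 0 ≤ A i j)
    {L : Matrix m m ℝ} (hL : L = diagonal (fun i => ∑ j, A i j) - A) :
    (L ^ 2).rank = L.rank := by
  have hker : LinearMap.ker (L ^ 2).mulVecLin = LinearMap.ker L.mulVecLin := by
    ext x
    simp only [LinearMap.mem_ker, mulVecLin_apply, pow_two, ← mulVec_mulVec]
    exact ⟨laplacian_mulVec_eq_zero_of_sq hA hL, fun h => by rw [h, mulVec_zero]⟩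
  have h₁ := (L ^ 2).mulVecLin.finrank_range_add_finrank_ker
  have h₂ := L.mulVecLin.finrank_range_add_finrank_ker
  rw [hker] at h₁
  unfold rank
  omega

theorem laplacian_mulVec_one {A L : Matrix m m ℝ}
    (hL : L = diagonal (fun i => ∑ j, A i j) - A) : L *ᵥ (fun _ => 1) = 0 := by
  funext i
  rw [hL, laplacian_mulVec_apply]
  simp

theorem index_laplacian_eq_one [Nonempty m] {A : Matrix m m ℝ} (hA : ∀ i j, 0 ≤ A i j)
    {L : Matrix m m ℝ} (hL : L = diagonal (fun i => ∑ j, A i j) - A) {ν : ℕ}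
    (hν : IsLeast {k : ℕ | (L ^ (k + 1)).rank = (L ^ k).rank} ν) : ν = 1 := by
  have hle : ν ≤ 1 := hν.2 (by simpa using rank_laplacian_sq hA hL)
  have hne : ν ≠ 0 := by
    rintro rfl
    have h : L.rank = Fintype.card m := by simpa using hν.1
    have hunit : IsUnit L := by
      rw [← mulVec_surjective_iff_isUnit, ← coe_mulVecLin, ← LinearMap.range_eq_top]
      exact Submodule.eq_top_of_finrank_eq (h.trans (by simp))
    have hone : (fun _ => 1 : m → ℝ) = 0 :=
      mulVec_injective_of_isUnit hunit (by rw [laplacian_mulVec_one hL, mulVec_zero])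
    exact one_ne_zero (congrFun hone (Classical.arbitrary m))
  omega

end Matrix


/-- S·J̃·S = J̃·S and rank(J̃·S) = 1. -/
theorem stmt14 {n : ℕ} (hn : 0 < n) (A L : Matrix (Fin n) (Fin n) ℝ)
    (hA : ∀ i j, 0 ≤ A i j)
    (hL : L = Matrix.diagonal (fun i => ∑ j, A i j) - A)
    (ν : ℕ) (hν : IsLeast {k : ℕ | (L ^ (k + 1)).rank = (L ^ k).rank} ν)
    (J : Matrix (Fin n) (Fin n) ℝ)
    (hJ2 : J * J = J)
    (hJr : LinearMap.range J.mulVecLin = LinearMap.ker (L ^ ν).mulVecLin)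
    (hJk : LinearMap.ker J.mulVecLin = LinearMap.range (L ^ ν).mulVecLin)
    (S : Matrix (Fin n) (Fin n) ℝ)
    (hSidem : S * S = S) (hSsymm : S.transpose = S)
    (hSrange : LinearMap.range S.mulVecLin =
      LinearMap.range L.mulVecLin ⊔ Submodule.span ℝ {(fun _ => 1 : Fin n → ℝ)}) :
    S * J * S = J * S ∧ (J * S).rank = 1 := by
  have : Nonempty (Fin n) := ⟨⟨0, hn⟩⟩
  obtain rfl := Matrix.index_laplacian_eq_one hA hL hν
  rw [pow_one] at hJr hJk
  set e : Fin n → ℝ := fun _ => 1 with he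
  have fix_of_mem {P : Matrix (Fin n) (Fin n) ℝ} (hP : P * P = P)
      (h : e ∈ LinearMap.range P.mulVecLin) : P.mulVec e = e := by
    obtain ⟨w, hw⟩ := h
    rw [Matrix.mulVecLin_apply] at hw
    rw [← hw, Matrix.mulVec_mulVec, hP]
  have hJe : J.mulVec e = e := fix_of_mem hJ2 <| by
    rw [hJr]
    exact Matrix.laplacian_mulVec_one hL
  have hSe : S.mulVec e = e := fix_of_mem hSidem <| by
    rw [hSrange]
    exact Submodule.mem_sup_right (Submodule.mem_span_singleton_self e)
  have hJS (v : Fin n → ℝ) : ∃ c : ℝ, c • e = (J * S).mulVec v := by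
    have hv : S.mulVec v ∈ LinearMap.range S.mulVecLin := ⟨v, rfl⟩
    rw [hSrange, ← hJk] at hv
    obtain ⟨y, hy, z, hz, hyz⟩ := Submodule.mem_sup.mp hv
    obtain ⟨c, rfl⟩ := Submodule.mem_span_singleton.mp hz
    have hy' : J.mulVec y = 0 := hy
    refine ⟨c, ?_⟩
    rw [← Matrix.mulVec_mulVec, ← hyz, Matrix.mulVec_add, hy', zero_add, Matrix.mulVec_smul, hJe]
  refine ⟨Matrix.mulVec_injective (funext fun v => ?_), ?_⟩
  · obtain ⟨c, hc⟩ := hJS v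
    rw [mul_assoc, ← Matrix.mulVec_mulVec, ← hc, Matrix.mulVec_smul, hSe]
  · have hrange : LinearMap.range (J * S).mulVecLin = Submodule.span ℝ {e} := by
      apply le_antisymm
      · rintro _ ⟨v, rfl⟩
        exact Submodule.mem_span_singleton.mpr (hJS v)
      · rw [Submodule.span_singleton_le_iff_mem]
        exact ⟨e, by rw [Matrix.mulVecLin_apply, ← Matrix.mulVec_mulVec, hSe, hJe]⟩
    rw [Matrix.rank, hrange]
    exact finrank_span_singleton fun h => one_ne_zero (congrFun h ⟨0, hn⟩)
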